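/- (Iterated tractor-D operators are independent of the extension off the null cone; the paper's display D_{A_1}⋯D_{A_ℓ}(U + QV) = D_{A_1}⋯D_{A_ℓ}U + QW, in the flat model.) Let g be a smooth function on ℝ^N ∖ {0} homogeneous of weight w ∈ ℝ, let ℓ ≥ 1 be an integer, and let A_1, …, A_ℓ ∈ Fin N. Define g_0 = Q · g (homogeneous of weight w + 2) and, for 1 ≤ j ≤ ℓ, g_j = (D^{(w+3−j)} g_{j−1})_{A_j}. Then g_ℓ is O(Q), i.e. there is a smooth function W on ℝ^N ∖ {0} with g_ℓ = Q · W. -/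

import Mathlib

open scoped BigOperators

/-- Partial derivative in the `A`-th coordinate direction. -/
noncomputable def pd {N : ℕ} (A : Fin N) (f : (Fin N → ℝ) → ℝ) : (Fin N → ℝ) → ℝ :=
  fun x => fderiv ℝ f x (Pi.single A 1)

/-- Ambient Laplacian `Δf = ∑_{A,B} h^{AB} ∂_A ∂_B f` w.r.t. the inverse metric `hInv`. -/
noncomputable def lap {N : ℕ} (hInv : Matrix (Fin N) (Fin N) ℝ)
    (f : (Fin N → ℝ) → ℝ) : (Fin N → ℝ) → ℝ :=
  fun x => ∑ A : Fin N, ∑ B : Fin N, hInv A B * pd A (pd B f) x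

/-- `X_A(x) = ∑_B h_{AB} x^B`. -/
def Xc {N : ℕ} (h : Matrix (Fin N) (Fin N) ℝ) (A : Fin N) : (Fin N → ℝ) → ℝ :=
  fun x => ∑ B : Fin N, h A B * x B

/-- `Q(x) = ∑_{A,B} h_{AB} x^A x^B`. -/
def Qfun {N : ℕ} (h : Matrix (Fin N) (Fin N) ℝ) : (Fin N → ℝ) → ℝ :=
  fun x => ∑ A : Fin N, ∑ B : Fin N, h A B * x A * x B

/-- Smooth (C^∞) on `ℝ^N ∖ {0}`. -/
def SmoothOffZero {N : ℕ} (f : (Fin N → ℝ) → ℝ) : Prop :=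
  ContDiffOn ℝ (⊤ : ℕ∞) f {x : Fin N → ℝ | x ≠ 0}

/-- Homogeneous of weight `w` on `ℝ^N ∖ {0}`. -/
def Homog {N : ℕ} (w : ℝ) (f : (Fin N → ℝ) → ℝ) : Prop :=
  ∀ x : Fin N → ℝ, x ≠ 0 → (∑ A : Fin N, x A * pd A f x) = w * f x

/-- Ambient tractor-D operator at weight `w`: `(D^{(w)} f)_A = (n+2w−2)∂_A f − X_A Δf`. -/
noncomputable def Dop {N : ℕ} (n : ℕ) (h hInv : Matrix (Fin N) (Fin N) ℝ) (w : ℝ)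
    (f : (Fin N → ℝ) → ℝ) (A : Fin N) : (Fin N → ℝ) → ℝ :=
  fun x => ((n : ℝ) + 2 * w - 2) * pd A f x - Xc h A x * lap hInv f x

/-- Iterated tractor-D: `seqD … w0 f A 0 = f` and
`seqD … w0 f A (j+1) = (D^{(w0−j)} (seqD … w0 f A j))_{A (j+1)}`. -/
noncomputable def seqD {N : ℕ} (n : ℕ) (h hInv : Matrix (Fin N) (Fin N) ℝ)
    (w0 : ℝ) (f : (Fin N → ℝ) → ℝ) (A : ℕ → Fin N) : ℕ → (Fin N → ℝ) → ℝ
  | 0 => f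
  | j + 1 => Dop n h hInv (w0 - (j : ℝ)) (seqD n h hInv w0 f A j) (A (j + 1))

/-- `u` is `O(Q^m)`: `u = Q^m · g` for some smooth `g` on `ℝ^N ∖ {0}`. -/
def BigOQ {N : ℕ} (h : Matrix (Fin N) (Fin N) ℝ) (m : ℕ) (u : (Fin N → ℝ) → ℝ) : Prop :=
  ∃ g : (Fin N → ℝ) → ℝ, SmoothOffZero g ∧
    ∀ x : Fin N → ℝ, x ≠ 0 → u x = (Qfun h x) ^ m * g x

section PartialDerivatives

variable {N : ℕ} {f g : (Fin N → ℝ) → ℝ} {x : Fin N → ℝ}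

theorem isOpen_ne_zero : IsOpen {x : Fin N → ℝ | x ≠ 0} := isOpen_ne

theorem SmoothOffZero.contDiffAt (hf : SmoothOffZero f) (hx : x ≠ 0) :
    ContDiffAt ℝ (⊤ : ℕ∞) f x :=
  ContDiffOn.contDiffAt hf (isOpen_ne_zero.mem_nhds hx)

theorem SmoothOffZero.differentiableAt (hf : SmoothOffZero f) (hx : x ≠ 0) :
    DifferentiableAt ℝ f x :=
  (hf.contDiffAt hx).differentiableAt (by simp)

theorem SmoothOffZero.pd (hf : SmoothOffZero f) (A : Fin N) : SmoothOffZero (pd A f) := by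
  have h1 : ContDiffOn ℝ (⊤ : ℕ∞) (fderiv ℝ f) {x : Fin N → ℝ | x ≠ 0} :=
    ContDiffOn.fderiv_of_isOpen hf isOpen_ne_zero (by simp)
  exact h1.clm_apply contDiffOn_const

theorem SmoothOffZero.mul (hf : SmoothOffZero f) (hg : SmoothOffZero g) :
    SmoothOffZero (fun y => f y * g y) :=
  ContDiffOn.mul hf hg

theorem SmoothOffZero.sub (hf : SmoothOffZero f) (hg : SmoothOffZero g) :
    SmoothOffZero (fun y => f y - g y) :=
  ContDiffOn.sub hf hg

theorem SmoothOffZero.const (c : ℝ) : SmoothOffZero (fun _ : Fin N → ℝ => c) :=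
  contDiffOn_const

theorem SmoothOffZero.sum {ι : Type*} {s : Finset ι} {F : ι → (Fin N → ℝ) → ℝ}
    (hF : ∀ i ∈ s, SmoothOffZero (F i)) : SmoothOffZero (fun y => ∑ i ∈ s, F i y) :=
  ContDiffOn.sum hF

theorem SmoothOffZero.coord (A : Fin N) : SmoothOffZero (fun y : Fin N → ℝ => y A) :=
  (contDiff_apply ℝ ℝ A).contDiffOn

theorem SmoothOffZero.lap (hf : SmoothOffZero f) (hInv : Matrix (Fin N) (Fin N) ℝ) :
    SmoothOffZero (lap hInv f) :=
  .sum fun A _ => .sum fun B _ => (SmoothOffZero.const _).mul ((hf.pd B).pd A)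

theorem smoothOffZero_Xc (h : Matrix (Fin N) (Fin N) ℝ) (A : Fin N) :
    SmoothOffZero (Xc h A) :=
  .sum fun B _ => (SmoothOffZero.const _).mul (.coord B)

theorem smoothOffZero_Qfun (h : Matrix (Fin N) (Fin N) ℝ) : SmoothOffZero (Qfun h) :=
  .sum fun A _ => .sum fun B _ => ((SmoothOffZero.const _).mul (.coord A)).mul (.coord B)

theorem pd_congr (hfg : ∀ y : Fin N → ℝ, y ≠ 0 → f y = g y) (A : Fin N) (hx : x ≠ 0) :
    pd A f x = pd A g x := by
  have : f =ᶠ[nhds x] g := Filter.eventually_of_mem (isOpen_ne_zero.mem_nhds hx) hfg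
  simp only [pd, this.fderiv_eq]

theorem lap_congr (hfg : ∀ y : Fin N → ℝ, y ≠ 0 → f y = g y)
    (hInv : Matrix (Fin N) (Fin N) ℝ) (hx : x ≠ 0) : lap hInv f x = lap hInv g x := by
  simp only [lap]
  refine Finset.sum_congr rfl fun A _ => Finset.sum_congr rfl fun B _ => ?_
  rw [pd_congr (fun y hy => pd_congr hfg B hy) A hx]

theorem pd_mul (A : Fin N) (hf : DifferentiableAt ℝ f x) (hg : DifferentiableAt ℝ g x) :
    pd A (fun y => f y * g y) x = pd A f x * g x + f x * pd A g x := by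
  simp only [pd, fderiv_fun_mul hf hg]
  simp
  ring

theorem pd_add (A : Fin N) (hf : DifferentiableAt ℝ f x) (hg : DifferentiableAt ℝ g x) :
    pd A (fun y => f y + g y) x = pd A f x + pd A g x := by
  simp [pd, fderiv_fun_add hf hg]

theorem pd_sub (A : Fin N) (hf : DifferentiableAt ℝ f x) (hg : DifferentiableAt ℝ g x) :
    pd A (fun y => f y - g y) x = pd A f x - pd A g x := by
  simp [pd, fderiv_fun_sub hf hg]

theorem pd_const_mul (A : Fin N) (c : ℝ) (hf : DifferentiableAt ℝ f x) :
    pd A (fun y => c * f y) x = c * pd A f x := by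
  simp [pd, fderiv_const_mul hf]

theorem pd_sum {ι : Type*} (s : Finset ι) {F : ι → (Fin N → ℝ) → ℝ} (A : Fin N)
    (hF : ∀ i ∈ s, DifferentiableAt ℝ (F i) x) :
    pd A (fun y => ∑ i ∈ s, F i y) x = ∑ i ∈ s, pd A (F i) x := by
  simp [pd, fderiv_fun_sum hF]

theorem pd_coord (A B : Fin N) : pd A (fun y => y B) x = if B = A then 1 else 0 := by
  have : fderiv ℝ (fun y : Fin N → ℝ => y B) x = ContinuousLinearMap.proj B :=
    (ContinuousLinearMap.proj (R := ℝ) (φ := fun _ : Fin N => ℝ) B).fderiv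
  simp [pd, this, Pi.single_apply]

theorem pd_Xc (h : Matrix (Fin N) (Fin N) ℝ) (A B : Fin N) : pd A (Xc h B) x = h B A := by
  have hc (C : Fin N) : DifferentiableAt ℝ (fun y : Fin N → ℝ => y C) x :=
    differentiableAt_apply C x
  unfold Xc
  rw [pd_sum _ _ fun C _ => (hc C).const_mul _]
  simp [pd_const_mul _ _ (hc _), pd_coord]

theorem pd_comm (hf : SmoothOffZero f) (hx : x ≠ 0) (A B : Fin N) :
    pd A (pd B f) x = pd B (pd A f) x := by
  have hd : DifferentiableAt ℝ (fderiv ℝ f) x :=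
    ((hf.contDiffAt hx).fderiv_right (m := 1) (by norm_cast)).differentiableAt (by simp)
  have key (C D : Fin N) : pd C (pd D f) x
      = fderiv ℝ (fderiv ℝ f) x (Pi.single C 1) (Pi.single D 1) := by
    unfold pd
    rw [fderiv_clm_apply hd (differentiableAt_const _)]
    simp
  rw [key, key]
  exact ((hf.contDiffAt hx).isSymmSndFDerivAt (by simp; norm_cast)) _ _

end PartialDerivatives

section Homogeneity

variable {N : ℕ} {f g : (Fin N → ℝ) → ℝ} {w v : ℝ}

theorem Homog.pd (hf : SmoothOffZero f) (hw : Homog w f) (B : Fin N) :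
    Homog (w - 1) (pd B f) := by
  intro x hx
  have hc (A : Fin N) : DifferentiableAt ℝ (fun y : Fin N → ℝ => y A) x :=
    differentiableAt_apply A x
  have hp (A : Fin N) := (hf.pd A).differentiableAt hx
  have e := pd_congr hw B hx
  rw [pd_const_mul _ _ (hf.differentiableAt hx),
    pd_sum _ _ fun A _ => (hc A).fun_mul (hp A)] at e
  simp only [pd_mul _ (hc _) (hp _), pd_coord, Finset.sum_add_distrib, ite_mul, one_mul,
    zero_mul, Finset.sum_ite_eq', Finset.mem_univ, if_true, pd_comm hf hx B] at e
  linarith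

theorem Homog.mul (hf : SmoothOffZero f) (hg : SmoothOffZero g) (hw : Homog w f)
    (hv : Homog v g) : Homog (w + v) (fun y => f y * g y) := by
  intro x hx
  simp only [pd_mul _ (hf.differentiableAt hx) (hg.differentiableAt hx)]
  calc _ = (∑ A, x A * _root_.pd A f x) * g x + f x * ∑ A, x A * _root_.pd A g x := by
        rw [Finset.sum_mul, Finset.mul_sum, ← Finset.sum_add_distrib]
        exact Finset.sum_congr rfl fun A _ => by ring
    _ = _ := by rw [hw x hx, hv x hx]; ring

theorem Homog.const_mul (hf : SmoothOffZero f) (hw : Homog w f) (c : ℝ) :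
    Homog w (fun y => c * f y) := by
  intro x hx
  simp only [pd_const_mul _ _ (hf.differentiableAt hx), mul_left_comm _ c, ← Finset.mul_sum,
    hw x hx]

theorem Homog.sub (hf : SmoothOffZero f) (hg : SmoothOffZero g) (hw : Homog w f)
    (hv : Homog w g) : Homog w (fun y => f y - g y) := by
  intro x hx
  simp only [pd_sub _ (hf.differentiableAt hx) (hg.differentiableAt hx), mul_sub,
    Finset.sum_sub_distrib, hw x hx, hv x hx]

theorem Homog.sum {ι : Type*} {s : Finset ι} {F : ι → (Fin N → ℝ) → ℝ}
    (hF : ∀ i ∈ s, SmoothOffZero (F i)) (hw : ∀ i ∈ s, Homog w (F i)) :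
    Homog w (fun y => ∑ i ∈ s, F i y) := by
  intro x hx
  simp only [pd_sum _ _ fun i hi => (hF i hi).differentiableAt hx, Finset.mul_sum]
  rw [Finset.sum_comm]
  exact Finset.sum_congr rfl fun i hi => hw i hi x hx

theorem Homog.lap (hf : SmoothOffZero f) (hw : Homog w f) (hInv : Matrix (Fin N) (Fin N) ℝ) :
    Homog (w - 1 - 1) (lap hInv f) := by
  have hs (A B : Fin N) := (hf.pd B).pd A
  refine .sum (fun A _ => .sum fun B _ => (SmoothOffZero.const _).mul (hs A B)) fun A _ =>
    .sum (fun B _ => (SmoothOffZero.const _).mul (hs A B)) fun B _ =>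
      .const_mul (hs A B) (.pd (hf.pd B) (hw.pd hf B) A) _

theorem homog_Xc (h : Matrix (Fin N) (Fin N) ℝ) (A : Fin N) : Homog 1 (Xc h A) := by
  intro x _
  simp only [pd_Xc, one_mul, Xc, mul_comm]

theorem Homog.Dop (n : ℕ) (h hInv : Matrix (Fin N) (Fin N) ℝ) (k : ℝ)
    (hf : SmoothOffZero f) (hw : Homog w f) (A : Fin N) :
    Homog (w - 1) (Dop n h hInv k f A) := by
  refine .sub ((SmoothOffZero.const _).mul (hf.pd A))
    ((smoothOffZero_Xc h A).mul (hf.lap hInv)) (.const_mul (hf.pd A) (hw.pd hf A) _) ?_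
  have := Homog.mul (smoothOffZero_Xc h A) (hf.lap hInv) (homog_Xc h A) (hw.lap hf hInv)
  rwa [show 1 + (w - 1 - 1) = w - 1 by ring] at this

theorem SmoothOffZero.Dop (n : ℕ) (h hInv : Matrix (Fin N) (Fin N) ℝ) (k : ℝ)
    (hf : SmoothOffZero f) (A : Fin N) : SmoothOffZero (Dop n h hInv k f A) :=
  ((SmoothOffZero.const _).mul (hf.pd A)).sub ((smoothOffZero_Xc h A).mul (hf.lap hInv))

end Homogeneity

section Quadric

variable {N : ℕ} {h hInv : Matrix (Fin N) (Fin N) ℝ} {f : (Fin N → ℝ) → ℝ}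
  {x : Fin N → ℝ} {w : ℝ}

theorem pd_Qfun (hSymm : ∀ A B, h A B = h B A) (hx : x ≠ 0) (C : Fin N) :
    pd C (Qfun h) x = 2 * Xc h C x := by
  have hc (A : Fin N) : DifferentiableAt ℝ (fun y : Fin N → ℝ => y A) x :=
    differentiableAt_apply A x
  have hX (A : Fin N) := (smoothOffZero_Xc h A).differentiableAt hx
  have hQ : Qfun h = fun y => ∑ A, y A * Xc h A y := by
    funext y
    simp only [Qfun, Xc, Finset.mul_sum]
    exact Finset.sum_congr rfl fun A _ => Finset.sum_congr rfl fun B _ => by ring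
  rw [hQ, pd_sum _ _ fun A _ => (hc A).fun_mul (hX A)]
  simp only [pd_mul _ (hc _) (hX _), pd_coord, pd_Xc, Finset.sum_add_distrib, ite_mul,
    one_mul, zero_mul, Finset.sum_ite_eq', Finset.mem_univ, if_true]
  have : ∑ A, x A * h A C = Xc h C x :=
    Finset.sum_congr rfl fun A _ => by rw [hSymm A C, mul_comm]
  rw [this]; ring

theorem pd_Qfun_mul (hSymm : ∀ A B, h A B = h B A) (hf : SmoothOffZero f) (hx : x ≠ 0)
    (A : Fin N) :
    pd A (fun y => Qfun h y * f y) x = 2 * Xc h A x * f x + Qfun h x * pd A f x := by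
  rw [pd_mul _ ((smoothOffZero_Qfun h).differentiableAt hx) (hf.differentiableAt hx),
    pd_Qfun hSymm hx]

theorem pd_pd_Qfun_mul (hSymm : ∀ A B, h A B = h B A) (hf : SmoothOffZero f) (hx : x ≠ 0)
    (A B : Fin N) :
    pd A (pd B (fun y => Qfun h y * f y)) x =
      2 * h B A * f x + 2 * (Xc h B x * pd A f x) + 2 * (Xc h A x * pd B f x)
        + Qfun h x * pd A (pd B f) x := by
  have hX := smoothOffZero_Xc h B
  have h2X : SmoothOffZero fun y => 2 * Xc h B y := (SmoothOffZero.const 2).mul hX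
  rw [pd_congr (fun y hy => pd_Qfun_mul hSymm hf hy B) A hx,
    pd_add _ ((h2X.mul hf).differentiableAt hx)
      (((smoothOffZero_Qfun h).mul (hf.pd B)).differentiableAt hx),
    pd_mul _ (h2X.differentiableAt hx) (hf.differentiableAt hx),
    pd_const_mul _ _ (hX.differentiableAt hx), pd_Xc, pd_Qfun_mul hSymm (hf.pd B) hx]
  ring

theorem sum_hInv_mul_Xc (hInvh : h * hInv = 1) (A : Fin N) :
    ∑ B, hInv A B * Xc h B x = x A := by
  have : hInv.mulVec (h.mulVec x) = x := by
    rw [Matrix.mulVec_mulVec, mul_eq_one_comm.mp hInvh, Matrix.one_mulVec]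
  exact congrFun this A

theorem sum_hInv_mul_Xc_left (hSymm : ∀ A B, h A B = h B A) (hInvh : h * hInv = 1)
    (B : Fin N) : ∑ A, hInv A B * Xc h A x = x B := by
  have hT : h.transpose = h := Matrix.ext fun A B => hSymm B A
  have h1 : h * hInv.transpose = 1 := by
    have := congrArg Matrix.transpose (mul_eq_one_comm.mp hInvh)
    rwa [Matrix.transpose_mul, hT, Matrix.transpose_one] at this
  exact sum_hInv_mul_Xc h1 B

theorem lap_Qfun_mul (hSymm : ∀ A B, h A B = h B A) (hInvh : h * hInv = 1)
    (hf : SmoothOffZero f) (hw : Homog w f) (hx : x ≠ 0) :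
    lap hInv (fun y => Qfun h y * f y) x =
      (2 * N + 4 * w) * f x + Qfun h x * lap hInv f x := by
  have htr : ∑ A, ∑ B, hInv A B * h B A = (N : ℝ) := by
    have := congrArg Matrix.trace (mul_eq_one_comm.mp hInvh)
    simpa [Matrix.trace, Matrix.mul_apply] using this
  have hE₁ : ∑ A, ∑ B, hInv A B * (Xc h B x * pd A f x) = w * f x := by
    rw [← hw x hx]
    refine Finset.sum_congr rfl fun A _ => ?_
    rw [← sum_hInv_mul_Xc (x := x) hInvh A, Finset.sum_mul]
    exact Finset.sum_congr rfl fun B _ => by ring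
  have hE₂ : ∑ A, ∑ B, hInv A B * (Xc h A x * pd B f x) = w * f x := by
    rw [← hw x hx, Finset.sum_comm]
    refine Finset.sum_congr rfl fun B _ => ?_
    rw [← sum_hInv_mul_Xc_left (x := x) hSymm hInvh B, Finset.sum_mul]
    exact Finset.sum_congr rfl fun A _ => by ring
  calc lap hInv (fun y => Qfun h y * f y) x
      = 2 * f x * (∑ A, ∑ B, hInv A B * h B A)
        + 2 * (∑ A, ∑ B, hInv A B * (Xc h B x * pd A f x))
        + 2 * (∑ A, ∑ B, hInv A B * (Xc h A x * pd B f x))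
        + Qfun h x * lap hInv f x := by
        simp only [lap, pd_pd_Qfun_mul hSymm hf hx, Finset.mul_sum, ← Finset.sum_add_distrib]
        exact Finset.sum_congr rfl fun A _ => Finset.sum_congr rfl fun B _ => by ring
    _ = _ := by rw [htr, hE₁, hE₂]; ring

/-- On `Q · f` with `f` homogeneous of weight `w`, the tractor-D operator at weight `w + 2`
commutes with multiplication by `Q`. -/
theorem Dop_Qfun_mul {n : ℕ} {h hInv : Matrix (Fin (n + 2)) (Fin (n + 2)) ℝ}
    {f : (Fin (n + 2) → ℝ) → ℝ} {x : Fin (n + 2) → ℝ}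
    (hSymm : ∀ A B, h A B = h B A) (hInvh : h * hInv = 1)
    (hf : SmoothOffZero f) (hw : Homog w f) (hx : x ≠ 0) (A : Fin (n + 2)) :
    Dop n h hInv (w + 2) (fun y => Qfun h y * f y) A x =
      Qfun h x * Dop n h hInv (w + 2) f A x := by
  simp only [Dop, pd_Qfun_mul hSymm hf hx, lap_Qfun_mul hSymm hInvh hf hw hx]
  push_cast
  ring

theorem exists_seqD_Qfun_mul {n : ℕ} {h hInv : Matrix (Fin (n + 2)) (Fin (n + 2)) ℝ}
    (hSymm : ∀ A B, h A B = h B A) (hInvh : h * hInv = 1)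
    {g : (Fin (n + 2) → ℝ) → ℝ} (hg : SmoothOffZero g) (hhom : Homog w g)
    (A : ℕ → Fin (n + 2)) (l : ℕ) :
    ∃ v, SmoothOffZero v ∧ Homog (w - l) v ∧ ∀ x, x ≠ 0 →
      seqD n h hInv (w + 2) (fun y => Qfun h y * g y) A l x = Qfun h x * v x := by
  induction l with
  | zero => exact ⟨g, hg, by simpa using hhom, fun x _ => rfl⟩
  | succ l ih =>
    obtain ⟨v, hv, hvw, hQV⟩ := ih
    refine ⟨Dop n h hInv (w - l + 2) v (A (l + 1)), hv.Dop _ _ _ _ _, ?_, fun x hx => ?_⟩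
    · have := hvw.Dop n h hInv (w - l + 2) hv (A (l + 1))
      rwa [sub_sub, ← Nat.cast_succ] at this
    · rw [← Dop_Qfun_mul hSymm hInvh hv hvw hx, seqD, Dop, Dop, pd_congr hQV _ hx,
        lap_congr hQV _ hx, show w + 2 - (l : ℝ) = w - l + 2 by ring]

end Quadric

/-- iterated tractor-D operators applied to `Q·g` stay `O(Q)`:
with `g_0 = Q·g` (weight `w+2`) and `g_j = (D^{(w+3−j)} g_{j−1})_{A_j}`,
the function `g_ℓ` is `O(Q)`. -/
theorem seqD_of_Q_mul
    (n : ℕ) (hn : 1 ≤ n)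
    (h hInv : Matrix (Fin (n + 2)) (Fin (n + 2)) ℝ)
    (hSymm : ∀ A B, h A B = h B A) (hInvh : h * hInv = 1)
    (w : ℝ) (g : (Fin (n + 2) → ℝ) → ℝ) (hg : SmoothOffZero g) (hhom : Homog w g)
    (l : ℕ) (hl : 1 ≤ l) (A : ℕ → Fin (n + 2)) :
    BigOQ h 1 (seqD n h hInv (w + 2) (fun y => Qfun h y * g y) A l) := by
  obtain ⟨v, hv, -, hQv⟩ := exists_seqD_Qfun_mul hSymm hInvh hg hhom A l
  exact ⟨v, hv, fun x hx => by rw [hQv x hx, pow_one]⟩
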